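/- Under Frobenius L_F-smoothness, with β = 0 and in the noiseless case (G_t = ∇f(Y_t), σ = 0), choosing μ = 0 and η = √(2Δ/(L_F r T)), Schedule-Free Spectral Descent satisfies for every T ≥ 1: (1/T)·Σ_{t=0}^{T−1} ‖∇f(Y_t)‖_* ≤ √(2 L_F r Δ / T). -/

import Mathlib

open Matrix MeasureTheory Finset Filter

noncomputable section

/-- Real `m × n` matrices. -/
abbrev Mat (m n : ℕ) := Matrix (Fin m) (Fin n) ℝ

/-- Frobenius (trace) inner product `⟨A, B⟩_F = tr(Aᵀ B)`. -/
def frobInner {m n : ℕ} (A B : Mat m n) : ℝ := ∑ i, ∑ j, A i j * B i j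

/-- Frobenius norm. -/
def frobNorm {m n : ℕ} (A : Mat m n) : ℝ := Real.sqrt (∑ i, ∑ j, (A i j) ^ 2)

/-- Spectral norm (`ℓ₂ → ℓ₂` operator norm, i.e. largest singular value). -/
def specNorm {m n : ℕ} (A : Mat m n) : ℝ :=
  sSup {c : ℝ | ∃ u : Fin n → ℝ, (∑ j, (u j) ^ 2) ≤ 1 ∧
    c = Real.sqrt (∑ i, (A.mulVec u i) ^ 2)}

/-- Nuclear norm (sum of singular values), via duality with the spectral norm. -/
def nucNorm {m n : ℕ} (A : Mat m n) : ℝ :=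
  sSup {c : ℝ | ∃ Q : Mat m n, specNorm Q ≤ 1 ∧ c = frobInner A Q}

/-- `P` is the polar factor `U Vᵀ` of a compact SVD `M = U Σ Vᵀ`
(`U`, `V` with orthonormal columns, `Σ` positive diagonal). -/
def IsPolarFactor {m n : ℕ} (M P : Mat m n) : Prop :=
  ∃ (k : ℕ) (U : Matrix (Fin m) (Fin k) ℝ) (V : Matrix (Fin n) (Fin k) ℝ)
    (s : Fin k → ℝ),
    Uᵀ * U = 1 ∧ Vᵀ * V = 1 ∧ (∀ i, 0 < s i) ∧
    M = U * Matrix.diagonal s * Vᵀ ∧ P = U * Vᵀ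

/-- `gradf` is the gradient of `f` with respect to the Frobenius inner product:
along every line `s ↦ A + s • H`, `f` has derivative `⟨gradf A, H⟩_F` at `s = 0`. -/
def IsGradient {m n : ℕ} (f : Mat m n → ℝ) (gradf : Mat m n → Mat m n) : Prop :=
  ∀ A H : Mat m n, HasDerivAt (fun s : ℝ => f (A + s • H)) (frobInner (gradf A) H) 0

theorem frobInner_eq_trace {m n : ℕ} (A B : Mat m n) : frobInner A B = trace (Aᵀ * B) := by
  simp only [frobInner, trace, Matrix.diag, mul_apply, transpose_apply]
  exact Finset.sum_comm

theorem frobNorm_sq {m n : ℕ} (A : Mat m n) : frobNorm A ^ 2 = frobInner A A := by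
  rw [frobNorm, Real.sq_sqrt (by positivity)]
  simp [frobInner, sq]

theorem frobNorm_smul {m n : ℕ} (c : ℝ) (A : Mat m n) : frobNorm (c • A) = |c| * frobNorm A := by
  simp only [frobNorm, Matrix.smul_apply, smul_eq_mul, mul_pow, ← Finset.mul_sum]
  rw [Real.sqrt_mul (sq_nonneg c), Real.sqrt_sq_eq_abs]

theorem frobInner_smul_right {m n : ℕ} (c : ℝ) (A B : Mat m n) :
    frobInner A (c • B) = c * frobInner A B := by
  simp [frobInner_eq_trace]

theorem frobInner_sub_left {m n : ℕ} (A B C : Mat m n) :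
    frobInner (A - B) C = frobInner A C - frobInner B C := by
  simp [frobInner_eq_trace, Matrix.sub_mul]

theorem frobInner_le_frobNorm_mul {m n : ℕ} (A B : Mat m n) :
    frobInner A B ≤ frobNorm A * frobNorm B := by
  simp only [frobInner, frobNorm, ← Fintype.sum_prod_type']
  exact Real.sum_mul_le_sqrt_mul_sqrt _ _ _

theorem sqrt_sum_mulVec_sq_le_specNorm {m n : ℕ} (Q : Mat m n) (u : Fin n → ℝ)
    (hu : ∑ j, u j ^ 2 ≤ 1) : Real.sqrt (∑ i, (Q.mulVec u i) ^ 2) ≤ specNorm Q := by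
  refine le_csSup ⟨frobNorm Q, ?_⟩ ⟨u, hu, rfl⟩
  rintro _ ⟨v, hv, rfl⟩
  refine Real.sqrt_le_sqrt (Finset.sum_le_sum fun i _ => ?_)
  calc (Q.mulVec v i) ^ 2 = (∑ j, Q i j * v j) ^ 2 := rfl
    _ ≤ (∑ j, Q i j ^ 2) * ∑ j, v j ^ 2 :=
        Finset.sum_mul_sq_le_sq_mul_sq _ _ _
    _ ≤ ∑ j, Q i j ^ 2 := mul_le_of_le_one_right (by positivity) hv

theorem sum_sq_col_eq_one {m k : ℕ} {U : Matrix (Fin m) (Fin k) ℝ} (hU : Uᵀ * U = 1) (i : Fin k) :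
    ∑ a, U a i ^ 2 = 1 := by
  have h := congrFun (congrFun hU i) i
  simpa [mul_apply, sq] using h

theorem card_le_of_transpose_mul_self_eq_one {m k : ℕ} {U : Matrix (Fin m) (Fin k) ℝ}
    (hU : Uᵀ * U = 1) : k ≤ m := by
  have h := rank_mul_le_right Uᵀ U
  rw [hU, rank_one, Fintype.card_fin] at h
  exact h.trans (by simpa using rank_le_card_height U)

theorem frobInner_svd {m n k : ℕ} (U : Matrix (Fin m) (Fin k) ℝ) (V : Matrix (Fin n) (Fin k) ℝ)
    (s : Fin k → ℝ) (Q : Mat m n) :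
    frobInner (U * diagonal s * Vᵀ) Q = ∑ i, s i * (Uᵀ * (Q * V)) i i := by
  rw [frobInner_eq_trace, transpose_mul, transpose_mul, transpose_transpose, diagonal_transpose,
    Matrix.mul_assoc, trace_mul_comm, Matrix.mul_assoc, Matrix.mul_assoc]
  simp [trace, diagonal_mul]

theorem IsPolarFactor.nucNorm_le {m n : ℕ} {M P : Mat m n} (h : IsPolarFactor M P) :
    nucNorm M ≤ frobInner M P := by
  obtain ⟨k, U, V, s, hU, hV, hs, rfl, rfl⟩ := h
  have hP : frobInner (U * diagonal s * Vᵀ) (U * Vᵀ) = ∑ i, s i := by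
    rw [frobInner_svd, Matrix.mul_assoc, hV, Matrix.mul_one, hU]
    simp
  rw [hP]
  refine Real.sSup_le ?_ (Finset.sum_nonneg fun i _ => (hs i).le)
  rintro _ ⟨Q, hQ, rfl⟩
  rw [frobInner_svd]
  refine Finset.sum_le_sum fun i _ => mul_le_of_le_one_right (hs i).le ?_
  have hcol := sqrt_sum_mulVec_sq_le_specNorm Q (fun j => V j i) (sum_sq_col_eq_one hV i).le
  calc (Uᵀ * (Q * V)) i i = ∑ a, U a i * Q.mulVec (fun j => V j i) a := rfl
    _ ≤ Real.sqrt (∑ a, U a i ^ 2) * Real.sqrt (∑ a, Q.mulVec (fun j => V j i) a ^ 2) :=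
        Real.sum_mul_le_sqrt_mul_sqrt _ _ _
    _ ≤ 1 := by
        rw [sum_sq_col_eq_one hU i, Real.sqrt_one, one_mul]
        exact hcol.trans hQ

theorem IsPolarFactor.frobNorm_sq_le {m n : ℕ} {M P : Mat m n} (h : IsPolarFactor M P) :
    frobNorm P ^ 2 ≤ ((min m n : ℕ) : ℝ) := by
  obtain ⟨k, U, V, s, hU, hV, -, -, rfl⟩ := h
  have hk : frobNorm (U * Vᵀ) ^ 2 = k := by
    have h := frobInner_svd U V (fun _ => 1) (U * Vᵀ)
    rw [diagonal_one, Matrix.mul_one, Matrix.mul_assoc, hV, Matrix.mul_one, hU] at h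
    rw [frobNorm_sq, h]
    simp
  rw [hk]
  exact_mod_cast le_min (card_le_of_transpose_mul_self_eq_one hU)
    (card_le_of_transpose_mul_self_eq_one hV)

/-- The descent lemma for a function with Lipschitz gradient in the Frobenius norm. -/
theorem IsGradient.descent {m n : ℕ} {f : Mat m n → ℝ} {gradf : Mat m n → Mat m n}
    (hgrad : IsGradient f gradf) {L : ℝ}
    (hsmooth : ∀ A B : Mat m n, frobNorm (gradf A - gradf B) ≤ L * frobNorm (A - B))
    (A H : Mat m n) :
    f (A + H) ≤ f A + frobInner (gradf A) H + L / 2 * frobNorm H ^ 2 := by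
  let φ : ℝ → ℝ := fun s =>
    f (A + s • H) - (s * frobInner (gradf A) H + L / 2 * frobNorm H ^ 2 * s ^ 2)
  have hφ (s : ℝ) : HasDerivAt φ (frobInner (gradf (A + s • H)) H -
      (1 * frobInner (gradf A) H + L / 2 * frobNorm H ^ 2 * (2 * s))) s := by
    have h₀ : HasDerivAt (fun x : ℝ => f (A + x • H)) (frobInner (gradf (A + s • H)) H) s := by
      have h := hgrad (A + s • H) H
      rw [← sub_self s] at h
      refine (h.comp_sub_const s s).congr_of_eventuallyEq (.of_forall fun x => ?_)
      simp only [sub_smul]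
      congr 1
      abel
    refine h₀.sub (((hasDerivAt_id s).mul_const _).add ?_)
    simpa using (hasDerivAt_pow 2 s).const_mul (L / 2 * frobNorm H ^ 2)
  have hanti : AntitoneOn φ (Set.Icc 0 1) := by
    refine antitoneOn_of_deriv_nonpos (convex_Icc 0 1)
      (fun s _ => (hφ s).continuousAt.continuousWithinAt)
      (fun s _ => (hφ s).differentiableAt.differentiableWithinAt) fun s hs => ?_
    rw [interior_Icc] at hs
    have hcs := frobInner_le_frobNorm_mul (gradf (A + s • H) - gradf A) H
    have hL := hsmooth (A + s • H) A
    rw [add_sub_cancel_left, frobNorm_smul, abs_of_pos hs.1] at hL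
    have hmul := mul_le_mul_of_nonneg_right hL (show 0 ≤ frobNorm H from Real.sqrt_nonneg _)
    rw [frobInner_sub_left] at hcs
    rw [(hφ s).deriv]
    linarith
  have h := hanti (Set.left_mem_Icc.2 zero_le_one) (Set.right_mem_Icc.2 zero_le_one) zero_le_one
  simp only [φ, zero_smul, one_smul, add_zero] at h
  linarith

/-- One spectral descent step of an arbitrary length. -/
theorem IsGradient.polar_step {m n : ℕ} {f : Mat m n → ℝ} {gradf : Mat m n → Mat m n}
    (hgrad : IsGradient f gradf) {L : ℝ} (hL : 0 < L)
    (hsmooth : ∀ A B : Mat m n, frobNorm (gradf A - gradf B) ≤ L * frobNorm (A - B))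
    {A P : Mat m n} (hP : IsPolarFactor (gradf A) P) (η : ℝ) :
    f (A - η • P) ≤ f A - η * frobInner (gradf A) P + L / 2 * ((min m n : ℕ) : ℝ) * η ^ 2 := by
  have h := hgrad.descent hsmooth A (-η • P)
  rw [frobInner_smul_right, frobNorm_smul, mul_pow, sq_abs, neg_sq, neg_smul,
    ← sub_eq_add_neg] at h
  have hk := mul_le_mul_of_nonneg_left hP.frobNorm_sq_le (by positivity : 0 ≤ L / 2 * η ^ 2)
  linarith

/-- **Noiseless rate for SF Spectral Descent with `β = 0`, `μ = 0`, Frobenius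
smoothness.** With `η = √(2Δ/(L_F r T))`, `r = min{m,n}`, for every `T ≥ 1`:
`(1/T)·Σ_{t<T} ‖∇f(Y_t)‖_* ≤ √(2 L_F r Δ / T)`. -/
theorem sf_frobenius_beta0_noiseless_rate {m n : ℕ}
    (f : Mat m n → ℝ) (gradf : Mat m n → Mat m n) (hgrad : IsGradient f gradf)
    (LF : ℝ) (hLF : 0 < LF)
    (hsmooth : ∀ A B : Mat m n, frobNorm (gradf A - gradf B) ≤ LF * frobNorm (A - B))
    (fstar : ℝ) (hfstar : ∀ W : Mat m n, fstar ≤ f W)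
    (hattain : ∃ W : Mat m n, f W = fstar) :
    ∀ T : ℕ, 1 ≤ T →
    ∀ Z P : ℕ → Mat m n,
      (∀ t, IsPolarFactor (gradf (Z t)) (P t)) →
      (∀ t, Z (t + 1) = Z t
        - Real.sqrt (2 * (f (Z 0) - fstar) / (LF * ((min m n : ℕ) : ℝ) * T)) • P t) →
      (1 / (T : ℝ)) * ∑ t ∈ Finset.range T, nucNorm (gradf (Z t)) ≤
        Real.sqrt (2 * LF * ((min m n : ℕ) : ℝ) * (f (Z 0) - fstar) / T) := by
  intro T hT Z P hP hZ
  have hT' : (0 : ℝ) < T := by exact_mod_cast hT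
  set r : ℝ := ((min m n : ℕ) : ℝ)
  have hr : 0 ≤ r := Nat.cast_nonneg _
  set Δ := f (Z 0) - fstar
  have hΔ0 : 0 ≤ Δ := sub_nonneg.2 (hfstar _)
  set η := Real.sqrt (2 * Δ / (LF * r * T)) with hη
  set N : ℕ → ℝ := fun t => frobInner (gradf (Z t)) (P t)
  suffices hsum : ∑ t ∈ Finset.range T, N t ≤ T * Real.sqrt (2 * LF * r * Δ / T) by
    rw [one_div, inv_mul_le_iff₀ hT']
    exact (Finset.sum_le_sum fun t _ => (hP t).nucNorm_le).trans hsum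
  by_cases hpos : 0 < r * Δ
  · have hr' : 0 < r := pos_of_mul_pos_left hpos hΔ0
    have hΔ' : 0 < Δ := pos_of_mul_pos_right hpos hr
    have hη' : 0 < η := Real.sqrt_pos.2 (by positivity)
    have hη2 : LF * r * T * η ^ 2 = 2 * Δ := by
      rw [hη, Real.sq_sqrt (by positivity)]
      field_simp
    have hroot : Real.sqrt (2 * LF * r * Δ / T) = LF * r * η := by
      have hsq : 2 * LF * r * Δ / T = (LF * r * η) ^ 2 := by
        rw [div_eq_iff hT'.ne']
        linear_combination -(LF * r) * hη2
      rw [hsq, Real.sqrt_sq (by positivity)]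
    have htel : ∑ t ∈ Finset.range T, η * N t ≤
        ∑ t ∈ Finset.range T, ((f (Z t) - f (Z (t + 1))) + LF / 2 * r * η ^ 2) := by
      refine Finset.sum_le_sum fun t _ => ?_
      have h := hgrad.polar_step hLF hsmooth (hP t) η
      rw [← hZ t] at h
      linarith
    rw [← Finset.mul_sum, Finset.sum_add_distrib, Finset.sum_range_sub', Finset.sum_const,
      Finset.card_range, nsmul_eq_mul] at htel
    rw [hroot]
    refine le_of_mul_le_mul_left ?_ hη'
    linarith [hfstar (Z T)]
  · have hzero : r * Δ = 0 := le_antisymm (not_lt.1 hpos) (mul_nonneg hr hΔ0)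
    have hη' : η = 0 := by
      rcases mul_eq_zero.1 hzero with h | h <;> simp [hη, h]
    have hconst (t : ℕ) : Z t = Z 0 := by
      induction t with
      | zero => rfl
      | succ t ih => rw [hZ t, hη', zero_smul, sub_zero, ih]
    have hN0 (t : ℕ) : N t = 0 := by
      have hdisc : discrim (LF / 2 * r) (-N t) Δ ≤ 0 := by
        refine discrim_le_zero fun h => ?_
        have hstep := hgrad.polar_step hLF hsmooth (hP t) h
        have hlow := hfstar (Z t - h • P t)
        have hft : f (Z t) = f (Z 0) := by rw [hconst t]
        linarith
      rw [discrim] at hdisc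
      have hsq : N t ^ 2 ≤ 0 := by linear_combination hdisc + 2 * LF * hzero
      exact pow_eq_zero_iff two_ne_zero |>.1 (le_antisymm hsq (sq_nonneg _))
    simp only [hN0, Finset.sum_const_zero]
    positivity
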